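/- Let p be a prime and let n be a positive integer such that √p ∈ ℚ(ζ_n). Then the polynomials Φ_n^+(x) = ∏_{j ∈ I_n^+} (x - w_n^j) and Φ_n^-(x) = ∏_{j ∈ I_n^-} (x - w_n^j) have all their coefficients in the subfield ℚ(√p) of ℂ and are irreducible over ℚ(√p). Equivalently, Φ_n^+ is the minimal polynomial of w_n over ℚ(√p), and for any k ∈ I_n^-, Φ_n^- is the minimal polynomial of w_n^k over ℚ(√p). -/

import Mathlib

open IntermediateField

/-- `w n = e^{2πi/n}`, a primitive `n`-th root of unity in `ℂ`. -/
noncomputable def w (n : ℕ) : ℂ := Complex.exp (2 * Real.pi * Complex.I / n)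

open scoped Classical in
/-- The index set `I_n^+`: for odd `p`, those `1 ≤ k ≤ n` coprime to `n` with
`((-1)^{(k-1)/2}·k / p) = 1`; for `p = 2`, those with `k ≡ ±1 (mod 8)`. -/
noncomputable def Iplus (p n : ℕ) [Fact p.Prime] : Finset ℕ :=
  (Finset.Icc 1 n).filter fun k =>
    Nat.gcd k n = 1 ∧
      (if p = 2 then k % 8 = 1 ∨ k % 8 = 7
       else legendreSym p ((-1) ^ ((k - 1) / 2) * (k : ℤ)) = 1)

open scoped Classical in
/-- The index set `I_n^-`: for odd `p`, those `1 ≤ k ≤ n` coprime to `n` with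
`((-1)^{(k-1)/2}·k / p) = -1`; for `p = 2`, those with `k ≡ ±3 (mod 8)`. -/
noncomputable def Iminus (p n : ℕ) [Fact p.Prime] : Finset ℕ :=
  (Finset.Icc 1 n).filter fun k =>
    Nat.gcd k n = 1 ∧
      (if p = 2 then k % 8 = 3 ∨ k % 8 = 5
       else legendreSym p ((-1) ^ ((k - 1) / 2) * (k : ℤ)) = -1)

open Polynomial in
theorem conj_root {n : ℕ} (hn : 0 < n) {μ ν : ℂ} (hμ : IsPrimitiveRoot μ n)
    (hν : IsPrimitiveRoot ν n) (g : ℚ[X]) (h : aeval μ g = 0) : aeval ν g = 0 := by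
  have h1 := Polynomial.cyclotomic_eq_minpoly_rat hμ hn
  have h2 := Polynomial.cyclotomic_eq_minpoly_rat hν hn
  have h3 := minpoly.dvd ℚ μ h
  rw [← h1, h2] at h3
  obtain ⟨q, rfl⟩ := h3
  simp

theorem w_prim {n : ℕ} (hn : 0 < n) : IsPrimitiveRoot (w n) n :=
  Complex.isPrimitiveRoot_exp n (Nat.pos_iff_ne_zero.1 hn)

/-- The sign character. -/
def chiS (p k : ℕ) [Fact p.Prime] : ℤ :=
  if p = 2 then (if k % 8 = 1 ∨ k % 8 = 7 then 1 else if k % 8 = 3 ∨ k % 8 = 5 then -1 else 0)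
  else legendreSym p ((-1) ^ ((k - 1) / 2) * (k : ℤ))

/-- The divisibility condition for `√p` to lie in the cyclotomic field. -/
def condS (p n : ℕ) : Prop :=
  if p = 2 then 8 ∣ n else p ∣ n ∧ (p % 4 = 3 → 4 ∣ n)

theorem mem_Iplus (p n : ℕ) [Fact p.Prime] (k : ℕ) :
    k ∈ Iplus p n ↔ (1 ≤ k ∧ k ≤ n) ∧ Nat.Coprime k n ∧ chiS p k = 1 := by
  unfold Iplus chiS Nat.Coprime
  rw [Finset.mem_filter, Finset.mem_Icc]
  split_ifs <;> simp_all

theorem mem_Iminus (p n : ℕ) [Fact p.Prime] (k : ℕ) :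
    k ∈ Iminus p n ↔ (1 ≤ k ∧ k ≤ n) ∧ Nat.Coprime k n ∧ chiS p k = -1 := by
  unfold Iminus chiS Nat.Coprime
  rw [Finset.mem_filter, Finset.mem_Icc]
  split_ifs <;> simp_all <;> omega

theorem sq_sign {p : ℕ} {z : ℂ} (h : z ^ 2 = p) :
    ∃ e : ℚ, z * (e : ℂ) = ((Real.sqrt p : ℝ) : ℂ) := by
  have h1 : (((Real.sqrt p : ℝ) : ℂ)) ^ 2 = p := by
    rw [← Complex.ofReal_pow, Real.sq_sqrt (Nat.cast_nonneg p)]; simp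
  rcases sq_eq_sq_iff_eq_or_eq_neg.1 (h.trans h1.symm) with h | h
  · exact ⟨1, by simp [h]⟩
  · exact ⟨-1, by simp [h]⟩

open Polynomial in
theorem exists_G_two {n : ℕ} (hn : 0 < n) (h8 : 8 ∣ n) [Fact (Nat.Prime 2)] :
    ∃ G : ℚ[X], ∀ k, Nat.Coprime k n →
      aeval (w n ^ k) G = (chiS 2 k : ℂ) * ((Real.sqrt (2 : ℕ) : ℝ) : ℂ) := by
  obtain ⟨m, rfl⟩ := h8
  have hz : IsPrimitiveRoot (w (8 * m) ^ m) 8 := (w_prim hn).pow hn (by ring)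
  set z := w (8 * m) ^ m with hzd
  have h8 : z ^ 8 = 1 := hz.pow_eq_one
  have h4 : z ^ 4 = -1 := by
    have h : z ^ 4 ≠ 1 := hz.pow_ne_one_of_pos_of_lt (by norm_num) (by norm_num)
    have : (z ^ 4 - 1) * (z ^ 4 + 1) = 0 := by linear_combination h8
    rcases mul_eq_zero.1 this with h' | h'
    · exact absurd (sub_eq_zero.1 h') h
    · linear_combination h'
  obtain ⟨e, he⟩ := sq_sign (p := 2) (z := z + z ^ 7) (by
    push_cast
    linear_combination (z^10 - z^6 + z^2 + 2*z^4-2) * h4)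
  refine ⟨(X ^ m + X ^ (7 * m)) * C e, fun k hk => ?_⟩
  rw [← he]
  have hk2 : k % 2 = 1 := by
    have : Nat.Coprime k 2 := hk.coprime_dvd_right ⟨4 * m, by ring⟩
    exact Nat.odd_iff.1 (Nat.coprime_two_right.1 this)
  have e1 : (w (8 * m) ^ k) ^ m = z ^ (k % 8) := by
    rw [pow_right_comm, ← hzd, pow_eq_pow_mod k h8]
  have e2 : (w (8 * m) ^ k) ^ (7 * m) = (z ^ (k % 8)) ^ 7 := by
    rw [mul_comm 7 m, pow_mul, e1]
  simp only [map_mul, map_add, map_pow, aeval_X, aeval_C, e1, e2, eq_ratCast]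
  unfold chiS
  have : k % 8 = 1 ∨ k % 8 = 3 ∨ k % 8 = 5 ∨ k % 8 = 7 := by omega
  rcases this with h | h | h | h <;> simp only [h] <;> norm_num
  · linear_combination e * (z^17 - z^13 + z^9 -z^5 + z + z^3) * h4
  · linear_combination e * (z^31 - z^27 + z^23 - z^19 + z^15 - z^11 + z^7 + z) * h4
  · left; linear_combination (z^45 - z^41 + z^37 - z^33 + z^29 - z^25 + z^21 - z^17 + z^13 - z^9 + z^5 - z) * h4

open Polynomial in
theorem exists_G_odd {p n : ℕ} [Fact p.Prime] (hn : 0 < n) (hp2 : p ≠ 2) (hpn : p ∣ n)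
    (h4 : p % 4 = 3 → 4 ∣ n) :
    ∃ G : ℚ[X], ∀ k, Nat.Coprime k n →
      aeval (w n ^ k) G = (chiS p k : ℂ) * ((Real.sqrt p : ℝ) : ℂ) := by
  have hp : p.Prime := Fact.out
  obtain ⟨m, hm⟩ := hpn
  have hz : IsPrimitiveRoot (w n ^ m) p := (w_prim hn).pow hn (by rw [hm, mul_comm])
  set z := w n ^ m with hzd
  have hF : ringChar (ZMod p) ≠ 2 := by rwa [ZMod.ringChar_zmod_n]
  set χ : MulChar (ZMod p) ℂ := (quadraticChar (ZMod p)).ringHomComp (Int.castRingHom ℂ) with hχ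
  set ψ : AddChar (ZMod p) ℂ := AddChar.zmodChar p hz.pow_eq_one with hψ
  have hψp : ψ.IsPrimitive := AddChar.zmodChar_primitive_of_primitive_root p hz
  have hχ1 : χ ≠ 1 := by
    rw [hχ, Ne, MulChar.ringHomComp_eq_one_iff (Int.cast_injective)]
    exact quadraticChar_ne_one hF
  have hχ2 : χ.IsQuadratic := (quadraticChar_isQuadratic (ZMod p)).comp _
  have hsq := gaussSum_sq hχ1 hχ2 hψp
  rw [ZMod.card] at hsq
  have hχa : ∀ a : ℤ, χ (a : ZMod p) = (legendreSym p a : ℂ) := fun a => by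
    rw [hχ, MulChar.ringHomComp_apply]; rfl
  have hneg : χ (-1) = ((ZMod.χ₄ p : ℤ) : ℂ) := by
    have := hχa (-1)
    rw [legendreSym.at_neg_one hp2] at this
    simpa using this
  let G0 : ℚ[X] := ∑ a : ZMod p, C ((quadraticChar (ZMod p) a : ℤ) : ℚ) * X ^ (m * a.val)
  have hG0 : ∀ k, Nat.Coprime k n → aeval (w n ^ k) G0 = (legendreSym p k : ℂ) * gaussSum χ ψ := by
    intro k hk
    have hkp : Nat.Coprime k p := hk.coprime_dvd_right ⟨m, hm⟩
    let u : (ZMod p)ˣ := ZMod.unitOfCoprime k hkp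
    have h1 : aeval (w n ^ k) G0 = gaussSum χ (ψ.mulShift u) := by
      simp only [G0, map_sum, map_mul, map_pow, aeval_X, aeval_C, gaussSum]
      refine Finset.sum_congr rfl fun a _ => ?_
      have h0 : (algebraMap ℚ ℂ) ((quadraticChar (ZMod p) a : ℤ) : ℚ) = χ a := by
        rw [hχ, MulChar.ringHomComp_apply]; simp
      rw [h0]
      congr 1
      · rw [AddChar.mulShift_apply]
        have : ((u : ZMod p) * a) = ((k * a.val : ℕ) : ZMod p) := by
          simp [u]
        rw [this, hψ, AddChar.zmodChar_apply', hzd]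
        rw [← pow_mul, ← pow_mul]; congr 1; ring
    have h2 := gaussSum_mulShift χ ψ u
    have h3 : χ u = (legendreSym p k : ℂ) := by
      rw [← hχa]; simp [u]
    rw [h1, ← h2, h3, ← mul_assoc, ← Int.cast_mul, ← sq]
    rw [legendreSym.sq_one]
    · simp
    · have := u.ne_zero
      simp only [u, ZMod.coe_unitOfCoprime] at this
      exact_mod_cast this
  have hp4 : p % 4 = 1 ∨ p % 4 = 3 := by
    have := hp.eq_two_or_odd; omega
  rcases hp4 with h1 | h3
  · have hc : ZMod.χ₄ p = 1 := ZMod.χ₄_nat_one_mod_four h1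
    rw [hneg, hc] at hsq
    obtain ⟨e, he⟩ := sq_sign (p := p) (z := gaussSum χ ψ) (by simpa using hsq)
    refine ⟨G0 * C e, fun k hk => ?_⟩
    rw [map_mul, hG0 k hk, aeval_C, ← he, ← mul_assoc]
    congr 2
    rw [chiS, if_neg hp2, legendreSym.mul]
    have : legendreSym p ((-1) ^ ((k - 1) / 2)) = 1 := by
      have := map_pow (legendreSym.hom p) (-1) ((k-1)/2)
      have h' : legendreSym p (-1) = 1 := by rw [legendreSym.at_neg_one hp2, hc]
      simp only [legendreSym.hom, MonoidWithZeroHom.coe_mk, ZeroHom.coe_mk] at this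
      rw [this, h', one_pow]
    rw [this, one_mul]
  · have hc : ZMod.χ₄ p = -1 := ZMod.χ₄_nat_three_mod_four h3
    rw [hneg, hc] at hsq
    obtain ⟨r, hr⟩ := h4 h3
    have hi : IsPrimitiveRoot (w n ^ r) 4 := (w_prim hn).pow hn (by rw [hr, mul_comm])
    set i := w n ^ r with hid
    have hi4 : i ^ 4 = 1 := hi.pow_eq_one
    have hi2 : i ^ 2 = -1 := by
      have h : i ^ 2 ≠ 1 := hi.pow_ne_one_of_pos_of_lt (by norm_num) (by norm_num)
      have : (i ^ 2 - 1) * (i ^ 2 + 1) = 0 := by linear_combination hi4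
      rcases mul_eq_zero.1 this with h' | h'
      · exact absurd (sub_eq_zero.1 h') h
      · linear_combination h'
    obtain ⟨e, he⟩ := sq_sign (p := p) (z := i * gaussSum χ ψ) (by
      rw [mul_pow, hi2, hsq]; simp)
    refine ⟨X ^ r * G0 * C e, fun k hk => ?_⟩
    have hk2 : k % 2 = 1 := by
      have : Nat.Coprime k 2 := hk.coprime_dvd_right ⟨2 * r, by rw [hr]; ring⟩
      exact Nat.odd_iff.1 (Nat.coprime_two_right.1 this)
    have hik : (w n ^ k) ^ r = (-1) ^ ((k - 1) / 2) * i := by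
      rw [pow_right_comm, ← hid, ← hi2, ← pow_mul i 2, ← pow_succ]
      congr 1; omega
    rw [map_mul, map_mul, hG0 k hk, aeval_C, ← he, map_pow, aeval_X, hik, chiS, if_neg hp2,
      legendreSym.mul]
    have : legendreSym p ((-1) ^ ((k - 1) / 2)) = (-1) ^ ((k - 1) / 2) := by
      have := map_pow (legendreSym.hom p) (-1) ((k-1)/2)
      have h' : legendreSym p (-1) = -1 := by rw [legendreSym.at_neg_one hp2, hc]
      simp only [legendreSym.hom, MonoidWithZeroHom.coe_mk, ZeroHom.coe_mk] at this
      rw [this, h']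
    rw [this]
    push_cast
    rw [eq_ratCast]
    ring

open Polynomial in
theorem exists_G {p n : ℕ} [Fact p.Prime] (hn : 0 < n) (h : condS p n) :
    ∃ G : ℚ[X], ∀ k, Nat.Coprime k n →
      aeval (w n ^ k) G = (chiS p k : ℂ) * ((Real.sqrt p : ℝ) : ℂ) := by
  unfold condS at h
  split_ifs at h with h2
  · subst h2; exact exists_G_two hn h
  · exact exists_G_odd hn h2 h.1 h.2

theorem sqrt_ne {p : ℕ} [hp : Fact p.Prime] : ((Real.sqrt p : ℝ) : ℂ) ≠ 0 := by
  have : (0 : ℝ) < p := by exact_mod_cast hp.out.pos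
  exact_mod_cast (Real.sqrt_pos.2 this).ne'

theorem w_pow_eq {n m : ℕ} (hm : 0 < m) : w (m * n) ^ m = w n := by
  unfold w
  rw [← Complex.exp_nat_mul]
  congr 1
  have : (m : ℂ) ≠ 0 := by exact_mod_cast hm.ne'
  by_cases h : (n : ℂ) = 0
  · simp [h]
  · push_cast; field_simp

open Polynomial in
/-- If `√p ∈ ℚ(w n)` then `chiS p k = 1` for `k ≡ 1 mod n`. -/
theorem chi_one {p n : ℕ} [hp : Fact p.Prime] (hn : 0 < n)
    (hs : ((Real.sqrt p : ℝ) : ℂ) ∈ ℚ⟮w n⟯) (k : ℕ) (hk : Nat.Coprime k (8 * p * n))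
    (hkn : k % n = 1 % n) : chiS p k = 1 := by
  have hN : 0 < 8 * p * n := by have := hp.out.pos; positivity
  have hint : IsIntegral ℚ (w n) := ((w_prim hn).isIntegral hn).tower_top
  have hs' : ((Real.sqrt p : ℝ) : ℂ) ∈ Algebra.adjoin ℚ {w n} := by
    rw [← IntermediateField.adjoin_simple_toSubalgebra_of_isAlgebraic hint.isAlgebraic]
    exact hs
  rw [Algebra.adjoin_singleton_eq_range_aeval] at hs'
  obtain ⟨f, hf⟩ := hs'
  change aeval (w n) f = _ at hf
  obtain ⟨G, hG⟩ := exists_G (p := p) (n := 8 * p * n) hN (by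
    unfold condS
    split_ifs
    · exact ⟨p * n, by ring⟩
    · exact ⟨⟨8 * n, by ring⟩, fun _ => ⟨2 * p * n, by ring⟩⟩)
  have hc1 : chiS p 1 = 1 := by unfold chiS; split_ifs <;> simp_all
  have h1 := hG 1 (Nat.coprime_one_left _)
  rw [hc1, pow_one] at h1
  have hw : w (8 * p * n) ^ (8 * p) = w n := w_pow_eq (by have := hp.out.pos; positivity)
  have key := conj_root hN (w_prim hN) ((w_prim hN).pow_of_coprime k hk)
    (f.comp (X ^ (8 * p)) - G) (by
      rw [map_sub, aeval_comp, map_pow, aeval_X, hw, hf, h1]; simp)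
  rw [map_sub, aeval_comp, map_pow, aeval_X, hG k hk, ← pow_mul, mul_comm k, pow_mul, hw,
    pow_eq_pow_mod k (w_prim hn).pow_eq_one, hkn,
    ← pow_eq_pow_mod 1 (w_prim hn).pow_eq_one, pow_one, hf] at key
  have : (chiS p k : ℂ) = 1 := by
    apply mul_right_cancel₀ (sqrt_ne (p := p))
    linear_combination -key
  exact_mod_cast this

theorem cond_of_mem {p n : ℕ} [hp : Fact p.Prime] (hn : 0 < n)
    (hs : ((Real.sqrt p : ℝ) : ℂ) ∈ ℚ⟮w n⟯) : condS p n := by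
  have H := chi_one hn hs
  unfold condS
  have hmod : ∀ l, n ∣ l → (1 + l) % n = 1 % n := by
    rintro _ ⟨l, rfl⟩; simp
  have cop : ∀ l d, d ∣ l → Nat.Coprime (1 + l) d := by
    rintro _ d ⟨l, rfl⟩; simp
  split_ifs with h2
  · subst h2
    by_contra h8
    obtain ⟨l, hn', hl⟩ : ∃ l, n ∣ l ∧ l % 8 = 4 := by
      by_cases h1 : n % 2 = 1
      · exact ⟨4 * n, ⟨4, by ring⟩, by omega⟩
      · by_cases h3 : n % 4 = 2
        · exact ⟨2 * n, ⟨2, by ring⟩, by omega⟩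
        · exact ⟨n, dvd_rfl, by omega⟩
    have h2c : Nat.Coprime (1 + l) 2 := cop _ _ (by omega)
    have := H (1 + l) (by
      refine Nat.Coprime.mul_right (?_ : Nat.Coprime _ (2 ^ 4)) (cop _ _ hn')
      exact h2c.pow_right 4) (hmod _ hn')
    have h5 : (1 + l) % 8 = 5 := by omega
    simp [chiS, h5] at this
  · have hodd : p % 2 = 1 := hp.out.eq_two_or_odd.resolve_left h2
    have hp2 : Nat.Coprime p 2 := Nat.coprime_two_right.2 (Nat.odd_iff.2 hodd)
    have hpn : p ∣ n := by
      by_contra hpn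
      have hF : ringChar (ZMod p) ≠ 2 := by rwa [ZMod.ringChar_zmod_n]
      obtain ⟨r, hr⟩ := FiniteField.exists_nonsquare hF
      have hc : Nat.Coprime p (4 * n) :=
        Nat.Coprime.mul_right (hp2.pow_right 2) ((Nat.Prime.coprime_iff_not_dvd hp.out).2 hpn)
      obtain ⟨k, hk1, hk2⟩ := Nat.chineseRemainder hc r.val 1
      have hkr : ((k : ℕ) : ZMod p) = r := by
        rw [(ZMod.natCast_eq_natCast_iff _ _ _).2 hk1, ZMod.natCast_zmod_val]
      have hk4 : k % 4 = 1 := Nat.ModEq.of_mul_right n hk2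
      have hkn : k % n = 1 % n := Nat.ModEq.of_mul_left 4 hk2
      have c1 : Nat.Coprime k 2 := Nat.coprime_two_right.2 (Nat.odd_iff.2 (by omega))
      have c2 : Nat.Coprime k p := by
        rw [Nat.coprime_comm, Nat.Prime.coprime_iff_not_dvd hp.out,
          ← ZMod.natCast_eq_zero_iff, hkr]
        rintro rfl
        exact hr (IsSquare.zero)
      have c3 : Nat.Coprime k n := by
        have : Nat.gcd k n = Nat.gcd 1 n := Nat.ModEq.gcd_eq hkn
        simpa [Nat.Coprime] using this
      have := H k (Nat.Coprime.mul_right (Nat.Coprime.mul_right (c1.pow_right 3) c2) c3) hkn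
      rw [chiS, if_neg h2, Even.neg_one_pow (by rw [Nat.even_iff]; omega), one_mul] at this
      have h' := legendreSym.eq_neg_one_iff' (p := p) (a := k) |>.2 (by rwa [hkr])
      omega
    refine ⟨hpn, fun h3 => ?_⟩
    by_contra h4
    obtain ⟨l, hn', hl⟩ : ∃ l, n ∣ l ∧ l % 4 = 2 := by
      by_cases h1 : n % 2 = 1
      · exact ⟨2 * n, ⟨2, by ring⟩, by omega⟩
      · exact ⟨n, dvd_rfl, by omega⟩
    have h2c : Nat.Coprime (1 + l) 2 := cop _ _ (by omega)
    have := H (1 + l) (Nat.Coprime.mul_right (Nat.Coprime.mul_right (h2c.pow_right 3)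
      (cop _ _ (hpn.trans hn'))) (cop _ _ hn')) (hmod _ hn')
    rw [chiS, if_neg h2, Odd.neg_one_pow (by rw [Nat.odd_iff]; omega), neg_one_mul,
      legendreSym.at_neg h2, ZMod.χ₄_nat_three_mod_four h3] at this
    have hl0 : (l : ZMod p) = 0 := (ZMod.natCast_eq_zero_iff _ _).2 (hpn.trans hn')
    have h1 : legendreSym p ((1 + l : ℕ) : ℤ) = 1 := by
      rw [legendreSym]; simp [hl0]
    rw [h1] at this
    omega

open Polynomial in
theorem conj_iff {p n : ℕ} [hp : Fact p.Prime] (hn : 0 < n) (G : ℚ[X])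
    (hG : ∀ k, Nat.Coprime k n →
      aeval (w n ^ k) G = (chiS p k : ℂ) * ((Real.sqrt p : ℝ) : ℂ))
    (e : ℤ) (he : e * e = 1) (k : ℕ) (hk : Nat.Coprime k n) (hke : chiS p k = e)
    (j : ℕ) (hj : Nat.Coprime j n) :
    aeval (w n ^ j) (minpoly ℚ⟮((Real.sqrt p : ℝ) : ℂ)⟯ (w n ^ k)) = 0 ↔ chiS p j = e := by
  set s : ℂ := ((Real.sqrt p : ℝ) : ℂ) with hs
  have hGk := hG k hk
  have hGj := hG j hj
  constructor
  · intro h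
    let F : (ℚ⟮s⟯)[X] := G.map (algebraMap ℚ ℚ⟮s⟯) - C ((e : ℚ⟮s⟯) * AdjoinSimple.gen ℚ s)
    have hF : ∀ z : ℂ, aeval z F = aeval z G - e * s := by
      intro z
      simp [F, aeval_map_algebraMap]
    have hd : minpoly ℚ⟮s⟯ (w n ^ k) ∣ F := minpoly.dvd _ _ (by rw [hF, hGk, hke, sub_self])
    obtain ⟨q, hq⟩ := hd
    have h0 : aeval (w n ^ j) F = 0 := by rw [hq, map_mul, h, zero_mul]
    rw [hF, hGj, ← sub_mul] at h0
    have := (mul_eq_zero.1 h0).resolve_right sqrt_ne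
    exact_mod_cast sub_eq_zero.1 this
  · intro h
    have hint : IsIntegral ℚ s := by
      refine IsIntegral.of_pow (n := 2) (by norm_num) ?_
      have : s ^ 2 = algebraMap ℚ ℂ p := by
        rw [hs, ← Complex.ofReal_pow, Real.sq_sqrt (Nat.cast_nonneg p)]; simp
      rw [this]
      exact isIntegral_algebraMap
    have hsurj : ∀ x : ℚ⟮s⟯, ∃ c : ℚ[X], aeval (AdjoinSimple.gen ℚ s) c = x := by
      rintro ⟨x, hx⟩
      have hx' : x ∈ Algebra.adjoin ℚ {s} := by
        rw [← IntermediateField.adjoin_simple_toSubalgebra_of_isAlgebraic hint.isAlgebraic]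
        exact hx
      rw [Algebra.adjoin_singleton_eq_range_aeval] at hx'
      obtain ⟨c, hc⟩ := hx'
      refine ⟨c, ?_⟩
      apply (algebraMap ℚ⟮s⟯ ℂ).injective
      rw [← aeval_algebraMap_apply, AdjoinSimple.algebraMap_gen]
      exact hc
    obtain ⟨P, hP⟩ := Polynomial.map_surjective
      (aeval (AdjoinSimple.gen ℚ s) : ℚ[X] →ₐ[ℚ] ℚ⟮s⟯).toRingHom hsurj
      (minpoly ℚ⟮s⟯ (w n ^ k))
    let H : ℚ[X] := P.eval₂ (aeval (C (e : ℚ) * G) : ℚ[X] →ₐ[ℚ] ℚ[X]).toRingHom X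
    have hH : ∀ z : ℂ, aeval z G = e * s →
        aeval z H = aeval z (minpoly ℚ⟮s⟯ (w n ^ k)) := by
      intro z hz
      rw [← hP, aeval_def z (map _ P), eval₂_map]
      change (aeval z : ℚ[X] →ₐ[ℚ] ℂ).toRingHom _ = _
      rw [hom_eval₂]
      congr 1
      · apply Polynomial.ringHom_ext'
        · exact Subsingleton.elim _ _
        · have he' : (e : ℂ) * e = 1 := by exact_mod_cast he
          simp [hz, ← mul_assoc, he']
      · simp
    have h1 : aeval (w n ^ k) H = 0 := by
      rw [hH _ (by rw [hGk, hke]), minpoly.aeval]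
    have h2 := conj_root hn ((w_prim hn).pow_of_coprime k hk)
      ((w_prim hn).pow_of_coprime j hj) H h1
    rwa [hH _ (by rw [hGj, h])] at h2

open Polynomial in
theorem minpoly_eq {p n : ℕ} [hp : Fact p.Prime] (hn : 0 < n) (hc : condS p n)
    (e : ℤ) (he : e * e = 1) (k : ℕ) (hk : Nat.Coprime k n) (hke : chiS p k = e)
    (I : Finset ℕ) (hI : ∀ j, j ∈ I ↔ (1 ≤ j ∧ j ≤ n) ∧ Nat.Coprime j n ∧ chiS p j = e) :
    (minpoly ℚ⟮((Real.sqrt p : ℝ) : ℂ)⟯ (w n ^ k)).map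
        (algebraMap ℚ⟮((Real.sqrt p : ℝ) : ℂ)⟯ ℂ) =
      ∏ j ∈ I, (X - C (w n ^ j)) := by
  obtain ⟨G, hG⟩ := exists_G hn hc
  have hiff := conj_iff hn G hG e he k hk hke
  have hprim := w_prim hn
  have hn1 : 1 < n := by
    unfold condS at hc
    split_ifs at hc
    · exact lt_of_lt_of_le (by norm_num) (Nat.le_of_dvd hn hc)
    · exact lt_of_lt_of_le hp.out.one_lt (Nat.le_of_dvd hn hc.1)
  set s : ℂ := ((Real.sqrt p : ℝ) : ℂ) with hs
  set M := minpoly ℚ⟮s⟯ (w n ^ k) with hM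
  have : NeZero n := ⟨hn.ne'⟩
  have hint : IsIntegral ℚ⟮s⟯ (w n ^ k) :=
    ((hprim.isIntegral hn).pow k).tower_top
  have hmon : (M.map (algebraMap ℚ⟮s⟯ ℂ)).Monic := (minpoly.monic hint).map _
  have hdvd : M.map (algebraMap ℚ⟮s⟯ ℂ) ∣ cyclotomic n ℂ := by
    rw [← map_cyclotomic n (algebraMap ℚ⟮s⟯ ℂ)]
    apply Polynomial.map_dvd
    apply minpoly.dvd
    rw [aeval_def, ← eval_map, map_cyclotomic]
    have : NeZero (n : ℂ) := ⟨by exact_mod_cast hn.ne'⟩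
    exact (isRoot_cyclotomic_iff.2 (hprim.pow_of_coprime k hk))
  have : NeZero (n : ℂ) := ⟨by exact_mod_cast hn.ne'⟩
  have hsep : (M.map (algebraMap ℚ⟮s⟯ ℂ)).Separable :=
    (separable_cyclotomic n ℂ).of_dvd hdvd
  have hroots : (M.map (algebraMap ℚ⟮s⟯ ℂ)).roots = I.val.map (fun j => w n ^ j) := by
    have hinj : Set.InjOn (fun j => w n ^ j) (I : Set ℕ) := by
      intro a ha b hb hab
      have ha' := (hI a).1 ha
      have hb' := (hI b).1 hb
      have hlt : ∀ j, (1 ≤ j ∧ j ≤ n) ∧ Nat.Coprime j n ∧ chiS p j = e → j < n := by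
        rintro j ⟨⟨_, h1⟩, h2, _⟩
        rcases h1.lt_or_eq with h | h
        · exact h
        · rw [h, Nat.coprime_self] at h2; omega
      exact hprim.pow_inj (hlt a ha') (hlt b hb') hab
    rw [Multiset.Nodup.ext (nodup_roots hsep)
      ((Multiset.nodup_map_iff_inj_on I.nodup).2 (fun a ha b hb => hinj ha hb))]
    intro z
    rw [mem_roots hmon.ne_zero, Multiset.mem_map]
    constructor
    · intro hz
      have hz' : IsPrimitiveRoot z n := isRoot_cyclotomic_iff.1 (hz.dvd hdvd)
      obtain ⟨j, hj, hjc, rfl⟩ := hprim.isPrimitiveRoot_iff.1 hz'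
      rw [IsRoot.def, eval_map, ← aeval_def, hiff j hjc] at hz
      refine ⟨j, (hI j).2 ⟨⟨?_, hj.le⟩, hjc, hz⟩, rfl⟩
      by_contra h0
      have : j = 0 := by omega
      rw [this, Nat.coprime_zero_left] at hjc
      omega
    · rintro ⟨j, hj, rfl⟩
      have hj' := (hI j).1 hj
      rw [IsRoot.def, eval_map, ← aeval_def, hiff j hj'.2.1]
      exact hj'.2.2
  rw [(IsAlgClosed.splits (M.map (algebraMap ℚ⟮s⟯ ℂ))).eq_prod_roots_of_monic hmon, hroots,
    Multiset.map_map]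
  rfl

/-- Let `p` be a prime and `n` a positive integer with `√p ∈ ℚ(ζ_n)`. Then
`Φ_n^+(x) = ∏_{j ∈ I_n^+} (x - w_n^j)` and `Φ_n^-(x) = ∏_{j ∈ I_n^-} (x - w_n^j)` have
coefficients in `ℚ(√p)` and are irreducible over `ℚ(√p)`; equivalently, `Φ_n^+` is the
minimal polynomial of `w_n` over `ℚ(√p)` and, for any `k ∈ I_n^-`, `Φ_n^-` is the minimal
polynomial of `w_n^k` over `ℚ(√p)`. -/
theorem phi_plus_minus_irreducible (p n : ℕ) [Fact p.Prime] (hn : 0 < n)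
    (hs : ((Real.sqrt p : ℝ) : ℂ) ∈ ℚ⟮w n⟯) :
    ((minpoly ℚ⟮((Real.sqrt p : ℝ) : ℂ)⟯ (w n)).map
        (algebraMap ℚ⟮((Real.sqrt p : ℝ) : ℂ)⟯ ℂ) =
      ∏ j ∈ Iplus p n, (Polynomial.X - Polynomial.C (w n ^ j))) ∧
    ∀ k ∈ Iminus p n,
      (minpoly ℚ⟮((Real.sqrt p : ℝ) : ℂ)⟯ (w n ^ k)).map
          (algebraMap ℚ⟮((Real.sqrt p : ℝ) : ℂ)⟯ ℂ) =
        ∏ j ∈ Iminus p n, (Polynomial.X - Polynomial.C (w n ^ j)) := by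
  have hc := cond_of_mem hn hs
  constructor
  · have hc1 : chiS p 1 = 1 := by unfold chiS; split_ifs <;> simp_all
    have := minpoly_eq hn hc 1 (by norm_num) 1 (Nat.coprime_one_left n) hc1 _ (mem_Iplus p n)
    rwa [pow_one] at this
  · intro k hk
    have hk' := (mem_Iminus p n k).1 hk
    exact minpoly_eq hn hc (-1) (by norm_num) k hk'.2.1 hk'.2.2 _ (mem_Iminus p n)
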